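/- Let μ₀ be the unique maximizer of I(μ) over Λ(γ,q), where 0 < q < 1 and γ > 0. Then μ₀ is symmetric about 0 (invariant under the map x ↦ −x) and its second moment equals the power budget exactly: ∫ x² dμ₀(x) = γ. -/

import Mathlib

open MeasureTheory Real Filter

/-- The standard Gaussian density `φ(t) = (2π)^{-1/2} e^{-t²/2}`. -/
noncomputable def gauss (t : ℝ) : ℝ := Real.exp (-t ^ 2 / 2) / Real.sqrt (2 * Real.pi)

/-- The output density `p_Y(y;μ) = ∫ φ(y−x) dμ(x)`. -/
noncomputable def outDen (μ : Measure ℝ) (y : ℝ) : ℝ := ∫ x, gauss (y - x) ∂μ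

/-- The relative entropy `d(x;μ) = ∫ φ(y−x) log(φ(y−x)/p_Y(y;μ)) dy`. -/
noncomputable def relEnt (x : ℝ) (μ : Measure ℝ) : ℝ :=
  ∫ y, gauss (y - x) * Real.log (gauss (y - x) / outDen μ y)

/-- The mutual information `I(μ) = ∫ d(x;μ) dμ(x)`. -/
noncomputable def mutInfo (μ : Measure ℝ) : ℝ := ∫ x, relEnt x μ ∂μ

/-- The constraint set `Λ(γ,q)`: probability measures with `μ({0}) ≥ q` and second moment
at most `γ`. -/
def memLam (γ q : ℝ) (μ : Measure ℝ) : Prop :=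
  IsProbabilityMeasure μ ∧ ENNReal.ofReal q ≤ μ {0} ∧
    ∫⁻ x, ENNReal.ofReal (x ^ 2) ∂μ ≤ ENNReal.ofReal γ

lemma gauss_eq : gauss = ProbabilityTheory.gaussianPDFReal 0 1 := by
  ext t
  simp [gauss, ProbabilityTheory.gaussianPDFReal_def, div_eq_inv_mul]

lemma gauss_integrable : Integrable gauss := by
  rw [gauss_eq]; exact ProbabilityTheory.integrable_gaussianPDFReal 0 1

lemma gauss_integral : ∫ t, gauss t = 1 := by
  rw [gauss_eq]; exact ProbabilityTheory.integral_gaussianPDFReal_eq_one 0 one_ne_zero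

lemma sqrt_two_pi_ge : 1 ≤ Real.sqrt (2 * Real.pi) := by
  rw [Real.one_le_sqrt]; nlinarith [Real.pi_gt_three]

lemma gauss_pos (t : ℝ) : 0 < gauss t := by
  have := sqrt_two_pi_ge
  unfold gauss; positivity

lemma gauss_le_one (t : ℝ) : gauss t ≤ 1 := by
  have := sqrt_two_pi_ge
  unfold gauss
  rw [div_le_one (by linarith)]
  refine le_trans (Real.exp_le_one_iff.2 ?_) this
  nlinarith [sq_nonneg t]

lemma gauss_cont : Continuous gauss := by
  unfold gauss; fun_prop

lemma gauss_neg (t : ℝ) : gauss (-t) = gauss t := by simp [gauss]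

lemma log_gauss (t : ℝ) : Real.log (gauss t) = -t ^ 2 / 2 - Real.log (Real.sqrt (2 * Real.pi)) := by
  have := sqrt_two_pi_ge
  unfold gauss
  rw [Real.log_div (Real.exp_pos _).ne' (by linarith), Real.log_exp]

lemma gauss_sq_integrable : Integrable (fun t => gauss t * t ^ 2) := by
  have h := (integrable_rpow_mul_exp_neg_mul_sq (b := 1/2) (by norm_num) (s := 2)
    (by norm_num)).mul_const (Real.sqrt (2 * Real.pi))⁻¹
  refine h.congr (ae_of_all _ fun t => ?_)
  simp only [gauss, Real.rpow_two]
  rw [show -t ^ 2 / 2 = -(1/2) * t ^ 2 by ring]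
  ring

lemma gauss_log_integrable : Integrable (fun t => gauss t * Real.log (gauss t)) := by
  refine ((gauss_sq_integrable.mul_const (-1/2)).sub
    (gauss_integrable.mul_const (Real.log (Real.sqrt (2 * Real.pi))))).congr
    (ae_of_all _ fun t => ?_)
  simp only [log_gauss, Pi.sub_apply]; ring

lemma gauss_int_meas (μ : Measure ℝ) [IsProbabilityMeasure μ] (y : ℝ) :
    Integrable (fun x => gauss (y - x)) μ := by
  refine (integrable_const (1 : ℝ)).mono' ?_ (ae_of_all _ fun x => ?_)
  · exact (gauss_cont.comp (by fun_prop)).aestronglyMeasurable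
  · rw [Real.norm_of_nonneg (gauss_pos _).le]; exact gauss_le_one _

lemma outDen_cont (μ : Measure ℝ) [IsProbabilityMeasure μ] : Continuous (outDen μ) := by
  refine continuous_of_dominated (bound := fun _ => (1 : ℝ)) (fun y => ?_) (fun y => ae_of_all _ fun x => ?_)
    (integrable_const _) (ae_of_all _ fun x => ?_)
  · exact (gauss_int_meas μ y).aestronglyMeasurable
  · rw [Real.norm_of_nonneg (gauss_pos _).le]; exact gauss_le_one _
  · exact gauss_cont.comp (by fun_prop)

lemma outDen_nonneg (μ : Measure ℝ) (y : ℝ) : 0 ≤ outDen μ y :=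
  integral_nonneg fun _ => (gauss_pos _).le

lemma outDen_le_one (μ : Measure ℝ) [IsProbabilityMeasure μ] (y : ℝ) : outDen μ y ≤ 1 := by
  have := integral_mono (gauss_int_meas μ y) (integrable_const (1 : ℝ)) (fun x => gauss_le_one _)
  simpa [outDen] using this

lemma outDen_ge (μ : Measure ℝ) [IsProbabilityMeasure μ] {q : ℝ} (hq : 0 < q)
    (h : ENNReal.ofReal q ≤ μ {0}) (y : ℝ) : q * gauss y ≤ outDen μ y := by
  have h1 : ∫ x in {0}, gauss (y - x) ∂μ ≤ outDen μ y :=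
    setIntegral_le_integral (gauss_int_meas μ y) (ae_of_all _ fun _ => (gauss_pos _).le)
  rw [integral_singleton] at h1
  have h2 : q ≤ μ.real {0} := by
    rw [Measure.real]
    exact (ENNReal.ofReal_le_iff_le_toReal (measure_ne_top _ _)).1 h
  simp only [sub_zero, smul_eq_mul] at h1
  nlinarith [gauss_pos y]

lemma outDen_pos (μ : Measure ℝ) [IsProbabilityMeasure μ] {q : ℝ} (hq : 0 < q)
    (h : ENNReal.ofReal q ≤ μ {0}) (y : ℝ) : 0 < outDen μ y :=
  lt_of_lt_of_le (mul_pos hq (gauss_pos y)) (outDen_ge μ hq h y)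

lemma log_outDen_bound (μ : Measure ℝ) [IsProbabilityMeasure μ] {q : ℝ} (hq : 0 < q)
    (h : ENNReal.ofReal q ≤ μ {0}) (x y : ℝ) :
    |Real.log (outDen μ y)| ≤
      |Real.log q| + Real.log (Real.sqrt (2 * Real.pi)) + (y - x) ^ 2 + x ^ 2 := by
  have h1 := Real.log_le_log (mul_pos hq (gauss_pos y)) (outDen_ge μ hq h y)
  rw [Real.log_mul hq.ne' (gauss_pos y).ne', log_gauss] at h1
  have h2 := Real.log_nonpos (outDen_nonneg μ y) (outDen_le_one μ y)
  rw [abs_of_nonpos h2]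
  have := neg_abs_le (Real.log q)
  nlinarith [sq_nonneg (y - 2 * x)]

/-- Joint integrability. -/
lemma joint_int (μ ρ : Measure ℝ) [IsProbabilityMeasure μ] [IsFiniteMeasure ρ] {q : ℝ}
    (hq : 0 < q) (h : ENNReal.ofReal q ≤ μ {0}) (hρ : Integrable (fun x => x ^ 2) ρ) :
    Integrable (fun z : ℝ × ℝ => gauss (z.2 - z.1) * Real.log (outDen μ z.2))
      (ρ.prod volume) := by
  set C := |Real.log q| + Real.log (Real.sqrt (2 * Real.pi)) with hC
  have hC0 : 0 ≤ C := add_nonneg (abs_nonneg _) (Real.log_nonneg sqrt_two_pi_ge)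
  have hbase : Integrable (fun z : ℝ × ℝ => gauss (z.2 - z.1) * (C + (z.2 - z.1) ^ 2 + z.1 ^ 2))
      (ρ.prod volume) := by
    have hx : ∀ x : ℝ, Integrable (fun y => gauss (y - x) * (C + (y - x) ^ 2 + x ^ 2)) := by
      intro x
      have := ((gauss_integrable.mul_const (C + x ^ 2)).add gauss_sq_integrable).comp_sub_right x
      refine this.congr (ae_of_all _ fun y => ?_)
      simp only [Pi.add_apply]; ring
    rw [integrable_prod_iff]
    · refine ⟨ae_of_all _ hx, ?_⟩
      have h2 : Integrable (fun x : ℝ => C + x ^ 2 + ∫ t, gauss t * t ^ 2) ρ :=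
        ((integrable_const _).add hρ).add (integrable_const _)
      refine h2.congr (ae_of_all _ fun x => ?_)
      have e : ∀ y, ‖gauss (y - x) * (C + (y - x) ^ 2 + x ^ 2)‖ =
          (fun t => gauss t * (C + x ^ 2) + gauss t * t ^ 2) (y - x) := by
        intro y
        rw [Real.norm_of_nonneg (mul_nonneg (gauss_pos _).le (by positivity))]
        ring
      simp only [e]
      rw [integral_sub_right_eq_self (fun t => gauss t * (C + x ^ 2) + gauss t * t ^ 2) x,
        integral_add (gauss_integrable.mul_const _) gauss_sq_integrable, integral_mul_const,
        gauss_integral]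
      ring
    · have : Continuous fun z : ℝ × ℝ => gauss (z.2 - z.1) * (C + (z.2 - z.1) ^ 2 + z.1 ^ 2) :=
        (gauss_cont.comp (by fun_prop)).mul (by fun_prop)
      exact this.aestronglyMeasurable
  refine hbase.mono' ?_ (ae_of_all _ fun z => ?_)
  · refine Measurable.aestronglyMeasurable ?_
    refine Measurable.mul ?_ ?_
    · exact (gauss_cont.comp (by fun_prop)).measurable
    · exact Real.measurable_log.comp ((outDen_cont μ).measurable.comp measurable_snd)
  · rw [norm_mul, Real.norm_of_nonneg (gauss_pos _).le]
    exact mul_le_mul_of_nonneg_left (log_outDen_bound μ hq h z.1 z.2) (gauss_pos _).le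

noncomputable def crossEnt (μ : Measure ℝ) (x : ℝ) : ℝ :=
  ∫ y, gauss (y - x) * Real.log (outDen μ y)

lemma slice_int (μ : Measure ℝ) [IsProbabilityMeasure μ] {q : ℝ}
    (hq : 0 < q) (h : ENNReal.ofReal q ≤ μ {0}) (x : ℝ) :
    Integrable (fun y => gauss (y - x) * Real.log (outDen μ y)) := by
  have hi := joint_int μ (Measure.dirac x) hq h (integrable_dirac (by simp))
  have := hi.prod_right_ae
  rwa [ae_dirac_eq, eventually_pure] at this

lemma crossEnt_int (μ ρ : Measure ℝ) [IsProbabilityMeasure μ] [IsFiniteMeasure ρ] {q : ℝ}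
    (hq : 0 < q) (h : ENNReal.ofReal q ≤ μ {0}) (hρ : Integrable (fun x => x ^ 2) ρ) :
    Integrable (crossEnt μ) ρ :=
  (joint_int μ ρ hq h hρ).integral_prod_left

lemma relEnt_eq (μ : Measure ℝ) [IsProbabilityMeasure μ] {q : ℝ}
    (hq : 0 < q) (h : ENNReal.ofReal q ≤ μ {0}) (x : ℝ) :
    relEnt x μ = (∫ t, gauss t * Real.log (gauss t)) - crossEnt μ x := by
  unfold relEnt crossEnt
  rw [← integral_sub_right_eq_self (fun t => gauss t * Real.log (gauss t)) x,
    ← integral_sub (gauss_log_integrable.comp_sub_right x) (slice_int μ hq h x)]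
  refine integral_congr_ae (ae_of_all _ fun y => ?_)
  simp only
  rw [Real.log_div (gauss_pos _).ne' (outDen_pos μ hq h y).ne']
  ring

lemma mutInfo_eq (μ : Measure ℝ) [IsProbabilityMeasure μ] {q : ℝ}
    (hq : 0 < q) (h : ENNReal.ofReal q ≤ μ {0}) (hμ : Integrable (fun x => x ^ 2) μ) :
    mutInfo μ = (∫ t, gauss t * Real.log (gauss t)) - ∫ x, crossEnt μ x ∂μ := by
  unfold mutInfo
  simp only [relEnt_eq μ hq h]
  rw [integral_sub (integrable_const _) (crossEnt_int μ μ hq h hμ)]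
  simp

lemma gauss_joint (μ : Measure ℝ) [IsProbabilityMeasure μ] :
    Integrable (fun z : ℝ × ℝ => gauss (z.2 - z.1)) (μ.prod volume) := by
  rw [integrable_prod_iff]
  · refine ⟨ae_of_all _ fun x => gauss_integrable.comp_sub_right x, ?_⟩
    refine (integrable_const (1 : ℝ)).congr (ae_of_all _ fun x => ?_)
    simp only [Real.norm_of_nonneg (gauss_pos _).le]
    rw [integral_sub_right_eq_self gauss x, gauss_integral]
  · exact (gauss_cont.comp (by fun_prop)).aestronglyMeasurable

lemma outDen_integrable (μ : Measure ℝ) [IsProbabilityMeasure μ] : Integrable (outDen μ) :=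
  (gauss_joint μ).integral_prod_right

lemma outDen_integral (μ : Measure ℝ) [IsProbabilityMeasure μ] : ∫ y, outDen μ y = 1 := by
  unfold outDen
  rw [← integral_integral_swap (f := fun x y => gauss (y - x)) (gauss_joint μ)]
  simp [integral_sub_right_eq_self gauss, gauss_integral]

lemma crossEnt_swap (μ ρ : Measure ℝ) [IsProbabilityMeasure μ] [IsProbabilityMeasure ρ] {q : ℝ}
    (hq : 0 < q) (h : ENNReal.ofReal q ≤ μ {0}) (hρ : Integrable (fun x => x ^ 2) ρ) :
    Integrable (fun y => outDen ρ y * Real.log (outDen μ y)) ∧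
    ∫ x, crossEnt μ x ∂ρ = ∫ y, outDen ρ y * Real.log (outDen μ y) := by
  have hj := joint_int μ ρ hq h hρ
  constructor
  · have := hj.integral_prod_right
    simp only [integral_mul_const] at this
    exact this
  · unfold crossEnt
    rw [integral_integral_swap (f := fun x y => gauss (y - x) * Real.log (outDen μ y)) hj]
    simp only [integral_mul_const]
    rfl

/-- The Gibbs inequality. -/
lemma gibbs (μ ρ : Measure ℝ) [IsProbabilityMeasure μ] [IsProbabilityMeasure ρ] {q : ℝ}
    (hq : 0 < q) (h : ENNReal.ofReal q ≤ μ {0}) (h' : ENNReal.ofReal q ≤ ρ {0})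
    (hρ : Integrable (fun x => x ^ 2) ρ) :
    ∫ x, crossEnt μ x ∂ρ ≤ ∫ x, crossEnt ρ x ∂ρ := by
  obtain ⟨i1, e1⟩ := crossEnt_swap μ ρ hq h hρ
  obtain ⟨i2, e2⟩ := crossEnt_swap ρ ρ hq h' hρ
  rw [e1, e2, ← sub_nonpos, ← integral_sub i1 i2]
  have : ∫ y, (outDen μ y - outDen ρ y) = 0 := by
    rw [integral_sub (outDen_integrable μ) (outDen_integrable ρ), outDen_integral,
      outDen_integral, sub_self]
  rw [← this]
  refine integral_mono (i1.sub i2) ((outDen_integrable μ).sub (outDen_integrable ρ)) fun y => ?_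
  have p1 := outDen_pos μ hq h y
  have p2 := outDen_pos ρ hq h' y
  have := Real.log_le_sub_one_of_pos (div_pos p1 p2)
  rw [Real.log_div p1.ne' p2.ne'] at this
  have h3 := mul_le_mul_of_nonneg_left this p2.le
  have h4 : outDen ρ y * (outDen μ y / outDen ρ y - 1) = outDen μ y - outDen ρ y := by
    field_simp
  simp only
  linarith

lemma crossEnt_nonpos (μ : Measure ℝ) [IsProbabilityMeasure μ] (x : ℝ) : crossEnt μ x ≤ 0 :=
  integral_nonpos fun y => mul_nonpos_of_nonneg_of_nonpos (gauss_pos _).le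
    (Real.log_nonpos (outDen_nonneg μ y) (outDen_le_one μ y))

lemma avg_int (μ : Measure ℝ) [IsProbabilityMeasure μ] (x : ℝ) :
    Integrable (fun y => gauss (y - x) * outDen μ y) := by
  refine (gauss_integrable.comp_sub_right x).mono' ?_ (ae_of_all _ fun y => ?_)
  · exact ((gauss_cont.comp (by fun_prop)).mul (outDen_cont μ)).aestronglyMeasurable
  · rw [Real.norm_of_nonneg (mul_nonneg (gauss_pos _).le (outDen_nonneg μ y))]
    exact mul_le_of_le_one_right (gauss_pos _).le (outDen_le_one μ y)

lemma crossEnt_le (μ : Measure ℝ) [IsProbabilityMeasure μ] {q : ℝ}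
    (hq : 0 < q) (h : ENNReal.ofReal q ≤ μ {0}) (x c : ℝ) (hc : 0 < c) :
    crossEnt μ x ≤ Real.log c - 1 + (∫ y, gauss (y - x) * outDen μ y) / c := by
  have e : Real.log c - 1 + (∫ y, gauss (y - x) * outDen μ y) / c =
      ∫ y, (gauss (y - x) * (Real.log c - 1) + gauss (y - x) * outDen μ y / c) := by
    rw [integral_add ((gauss_integrable.comp_sub_right x).mul_const _) ((avg_int μ x).div_const _),
      integral_mul_const, integral_div, integral_sub_right_eq_self gauss x, gauss_integral, one_mul]
  rw [e]
  refine integral_mono (slice_int μ hq h x)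
    (((gauss_integrable.comp_sub_right x).mul_const _).add ((avg_int μ x).div_const _)) fun y => ?_
  have p1 := outDen_pos μ hq h y
  have := Real.log_le_sub_one_of_pos (div_pos p1 hc)
  rw [Real.log_div p1.ne' hc.ne'] at this
  have h3 : Real.log (outDen μ y) ≤ Real.log c - 1 + outDen μ y / c := by linarith
  have h4 := mul_le_mul_of_nonneg_left h3 (gauss_pos (y - x)).le
  simp only
  calc _ ≤ _ := h4
    _ = _ := by ring

lemma gauss_tendsto : Tendsto gauss atTop (nhds 0) := by
  have h : Tendsto (fun t : ℝ => Real.exp (-t ^ 2 / 2)) atTop (nhds 0) := by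
    refine Real.tendsto_exp_atBot.comp ?_
    have : Tendsto (fun t : ℝ => t ^ 2 / 2) atTop atTop :=
      (tendsto_pow_atTop two_ne_zero).atTop_div_const (by norm_num)
    refine (tendsto_neg_atTop_atBot.comp this).congr fun t => ?_
    simp only [Function.comp]; ring
  have h2 := h.div_const (Real.sqrt (2 * Real.pi))
  rw [zero_div] at h2
  exact h2

lemma outDen_tendsto (μ : Measure ℝ) [IsProbabilityMeasure μ] :
    Tendsto (outDen μ) atTop (nhds 0) := by
  have := tendsto_integral_filter_of_dominated_convergence (μ := μ) (l := atTop)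
    (F := fun y x => gauss (y - x)) (f := fun _ => 0) (fun _ => (1 : ℝ))
    (Eventually.of_forall fun y => (gauss_int_meas μ y).aestronglyMeasurable)
    (Eventually.of_forall fun y => ae_of_all _ fun x => by
      rw [Real.norm_of_nonneg (gauss_pos _).le]; exact gauss_le_one _)
    (integrable_const _)
    (ae_of_all _ fun x => gauss_tendsto.comp (tendsto_atTop_add_const_right _ (-x) tendsto_id))
  rw [integral_zero] at this
  exact this

lemma avg_tendsto (μ : Measure ℝ) [IsProbabilityMeasure μ] :
    Tendsto (fun x => ∫ y, gauss (y - x) * outDen μ y) atTop (nhds 0) := by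
  have e : ∀ x, ∫ y, gauss (y - x) * outDen μ y = ∫ t, gauss t * outDen μ (t + x) := by
    intro x
    rw [← integral_sub_right_eq_self (fun t => gauss t * outDen μ (t + x)) x]
    simp
  simp only [e]
  have := tendsto_integral_filter_of_dominated_convergence (μ := volume) (l := atTop)
    (F := fun x t => gauss t * outDen μ (t + x)) (f := fun _ => 0) gauss
    (Eventually.of_forall fun x =>
      (gauss_cont.mul ((outDen_cont μ).comp (by fun_prop))).aestronglyMeasurable)
    (Eventually.of_forall fun x => ae_of_all _ fun t => by
      rw [Real.norm_of_nonneg (mul_nonneg (gauss_pos _).le (outDen_nonneg μ _))]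
      exact mul_le_of_le_one_right (gauss_pos _).le (outDen_le_one μ _))
    gauss_integrable
    (ae_of_all _ fun t => by
      have := ((outDen_tendsto μ).comp
        (tendsto_atTop_add_const_left atTop t tendsto_id)).const_mul (gauss t)
      simpa using this)
  simpa using this

lemma sq_integrable {γ : ℝ} (μ : Measure ℝ)
    (h : ∫⁻ x, ENNReal.ofReal (x ^ 2) ∂μ ≤ ENNReal.ofReal γ) :
    Integrable (fun x : ℝ => x ^ 2) μ := by
  refine ⟨(continuous_pow 2).aestronglyMeasurable, ?_⟩
  rw [hasFiniteIntegral_iff_ofReal (ae_of_all _ fun x => sq_nonneg x)]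
  exact lt_of_le_of_lt h ENNReal.ofReal_lt_top

/-- The perturbed measure. -/
noncomputable def pert (μ : Measure ℝ) (q ε x : ℝ) : Measure ℝ :=
  ENNReal.ofReal (1 - ε) • μ +
    (ENNReal.ofReal (ε * q) • Measure.dirac 0 + ENNReal.ofReal (ε * (1 - q)) • Measure.dirac x)

lemma pert_integral (μ : Measure ℝ) {q ε x : ℝ} (hq0 : 0 < q) (hq1 : q < 1) (he0 : 0 < ε)
    (he1 : ε < 1) (f : ℝ → ℝ) (hf : Integrable f μ) :
    ∫ t, f t ∂(pert μ q ε x) =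
      (1 - ε) * (∫ t, f t ∂μ) + (ε * q * f 0 + ε * (1 - q) * f x) := by
  have i1 : Integrable f (ENNReal.ofReal (1 - ε) • μ) := hf.smul_measure ENNReal.ofReal_ne_top
  have i2 : ∀ c a : ℝ, Integrable f (ENNReal.ofReal c • Measure.dirac a) := fun c a =>
    (integrable_dirac (by simp)).smul_measure ENNReal.ofReal_ne_top
  unfold pert
  rw [integral_add_measure i1 ((i2 _ _).add_measure (i2 _ _)), integral_add_measure (i2 _ _) (i2 _ _)]
  simp only [integral_smul_measure, integral_dirac, smul_eq_mul]
  rw [ENNReal.toReal_ofReal (by linarith), ENNReal.toReal_ofReal (by positivity),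
    ENNReal.toReal_ofReal (mul_nonneg he0.le (by linarith))]

lemma pert_prob (μ : Measure ℝ) [IsProbabilityMeasure μ] {q ε x : ℝ} (hq0 : 0 < q) (hq1 : q < 1)
    (he0 : 0 < ε) (he1 : ε < 1) : IsProbabilityMeasure (pert μ q ε x) := by
  constructor
  simp only [pert, Measure.add_apply, Measure.smul_apply, measure_univ, smul_eq_mul, mul_one]
  have : 0 ≤ ε * (1 - q) := mul_nonneg he0.le (by linarith)
  rw [← ENNReal.ofReal_add (by positivity) this, ← ENNReal.ofReal_add (by linarith) (by positivity)]
  rw [← ENNReal.ofReal_one]; congr 1; ring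

lemma pert_zero (μ : Measure ℝ) {q ε x : ℝ} (hq0 : 0 < q)
    (he0 : 0 < ε) (he1 : ε < 1) (h : ENNReal.ofReal q ≤ μ {0}) :
    ENNReal.ofReal q ≤ pert μ q ε x {0} := by
  calc ENNReal.ofReal q = ENNReal.ofReal (1 - ε) * ENNReal.ofReal q + ENNReal.ofReal (ε * q) := by
        rw [← ENNReal.ofReal_mul (by linarith), ← ENNReal.ofReal_add
          (mul_nonneg (by linarith) hq0.le) (by positivity)]
        congr 1; ring
    _ ≤ ENNReal.ofReal (1 - ε) * μ {0} + (ENNReal.ofReal (ε * q) + ENNReal.ofReal (ε * (1 - q)) *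
          Measure.dirac x {0}) := by
        gcongr
        exact le_self_add
    _ = _ := by simp [pert]

lemma pert_moment (μ : Measure ℝ) {q ε x m γ : ℝ} (hq1 : q < 1) (hq0 : 0 < q)
    (he0 : 0 < ε) (he1 : ε < 1) (hm : 0 ≤ m)
    (h : ∫⁻ x, ENNReal.ofReal (x ^ 2) ∂μ = ENNReal.ofReal m)
    (hle : m + ε * x ^ 2 ≤ γ) :
    ∫⁻ t, ENNReal.ofReal (t ^ 2) ∂(pert μ q ε x) ≤ ENNReal.ofReal γ := by
  simp only [pert, lintegral_add_measure, lintegral_smul_measure, smul_eq_mul, h]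
  rw [lintegral_dirac, lintegral_dirac]
  have : 0 ≤ ε * (1 - q) := mul_nonneg he0.le (by linarith)
  rw [← ENNReal.ofReal_mul (by linarith), ← ENNReal.ofReal_mul (by positivity),
    ← ENNReal.ofReal_mul this, ← ENNReal.ofReal_add (by positivity) (by positivity),
    ← ENNReal.ofReal_add (mul_nonneg (by linarith) hm) (by positivity)]
  apply ENNReal.ofReal_le_ofReal
  have h1 : 0 ≤ ε * m := by positivity
  have h2 : 0 ≤ ε * q * x ^ 2 := by positivity
  nlinarith

lemma pert_outDen_le (μ : Measure ℝ) [IsProbabilityMeasure μ] {q ε x : ℝ} (hq0 : 0 < q)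
    (hq1 : q < 1) (he0 : 0 < ε) (he1 : ε < 1) (y : ℝ) :
    outDen (pert μ q ε x) y ≤ outDen μ y + ε := by
  have := pert_integral μ (x := x) hq0 hq1 he0 he1 _ (gauss_int_meas μ y)
  have h0 := outDen_nonneg μ y
  unfold outDen at *
  rw [this]
  have h1 : ε * q * gauss (y - 0) ≤ ε * q := mul_le_of_le_one_right (by positivity) (gauss_le_one _)
  have h2 : ε * (1 - q) * gauss (y - x) ≤ ε * (1 - q) :=
    mul_le_of_le_one_right (mul_nonneg he0.le (by linarith)) (gauss_le_one _)
  nlinarith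

lemma full_power {q γ : ℝ} (hq0 : 0 < q) (hq1 : q < 1)
    (μ₀ : Measure ℝ) (h₀ : memLam γ q μ₀)
    (hmax : ∀ μ : Measure ℝ, memLam γ q μ → mutInfo μ ≤ mutInfo μ₀) :
    ∫⁻ x, ENNReal.ofReal (x ^ 2) ∂μ₀ = ENNReal.ofReal γ := by
  obtain ⟨hp, hz, hm⟩ := h₀
  by_contra hne
  have hlt := lt_of_le_of_ne hm hne
  have hsq := sq_integrable μ₀ hm
  set m := (∫⁻ x, ENNReal.ofReal (x ^ 2) ∂μ₀).toReal with hmdef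
  have hmeq : ∫⁻ x, ENNReal.ofReal (x ^ 2) ∂μ₀ = ENNReal.ofReal m :=
    (ENNReal.ofReal_toReal hlt.ne_top).symm
  have hm0 : 0 ≤ m := ENNReal.toReal_nonneg
  have hmγ : m < γ := by
    rw [hmeq] at hlt
    exact (ENNReal.ofReal_lt_ofReal_iff_of_nonneg hm0).1 hlt
  set J := ∫ x, crossEnt μ₀ x ∂μ₀ with hJ
  set c := Real.exp (J / (1 - q) - 1) with hc
  have hc0 : 0 < c := Real.exp_pos _
  obtain ⟨x, hx⟩ := ((avg_tendsto μ₀).eventually (gt_mem_nhds (half_pos hc0))).exists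
  obtain ⟨ε, he0, he⟩ : ∃ ε : ℝ, 0 < ε ∧ ε < min (min 1 (c / 2)) ((γ - m) / (x ^ 2 + 1)) := by
    refine exists_between ?_
    refine lt_min (lt_min one_pos (half_pos hc0)) (div_pos (by linarith) (by positivity))
  obtain ⟨he, he3⟩ := lt_min_iff.1 he
  obtain ⟨he1, he2⟩ := lt_min_iff.1 he
  rw [lt_div_iff₀ (by positivity)] at he3
  have hpp : IsProbabilityMeasure (pert μ₀ q ε x) := pert_prob μ₀ hq0 hq1 he0 he1
  have hpz := pert_zero μ₀ (x := x) hq0 he0 he1 hz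
  have hpm : ∫⁻ t, ENNReal.ofReal (t ^ 2) ∂(pert μ₀ q ε x) ≤ ENNReal.ofReal γ :=
    pert_moment μ₀ hq1 hq0 he0 he1 hm0 hmeq (by nlinarith)
  have hle := hmax _ ⟨hpp, hpz, hpm⟩
  rw [mutInfo_eq _ hq0 hpz (sq_integrable _ hpm), mutInfo_eq _ hq0 hz hsq,
    pert_integral μ₀ hq0 hq1 he0 he1 _ (crossEnt_int _ μ₀ hq0 hpz hsq)] at hle
  have hg := gibbs (pert μ₀ q ε x) μ₀ hq0 hpz hz hsq
  have hn := crossEnt_nonpos (pert μ₀ q ε x) 0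
  have hL := crossEnt_le (pert μ₀ q ε x) hq0 hpz x c hc0
  have hA : ∫ y, gauss (y - x) * outDen (pert μ₀ q ε x) y ≤ c := by
    have i2 : Integrable (fun y => gauss (y - x) * ε) :=
      (gauss_integrable.comp_sub_right x).mul_const ε
    have : ∫ y, gauss (y - x) * outDen (pert μ₀ q ε x) y ≤
        ∫ y, (gauss (y - x) * outDen μ₀ y + gauss (y - x) * ε) := by
      refine integral_mono (avg_int _ x) ((avg_int μ₀ x).add i2) fun y => ?_
      simp only
      rw [← mul_add]
      exact mul_le_mul_of_nonneg_left (pert_outDen_le μ₀ hq0 hq1 he0 he1 y) (gauss_pos _).le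
    rw [integral_add (avg_int μ₀ x) i2, integral_mul_const,
      integral_sub_right_eq_self gauss x, gauss_integral] at this
    linarith
  have hA' := (div_le_one hc0).2 hA
  have hlc : Real.log c = J / (1 - q) - 1 := Real.log_exp _
  have hL2 : crossEnt (pert μ₀ q ε x) x ≤ J / (1 - q) - 1 := by linarith
  have h1q : 0 < 1 - q := by linarith
  have hL3 : (1 - q) * crossEnt (pert μ₀ q ε x) x ≤ J - (1 - q) := by
    have := mul_le_mul_of_nonneg_left hL2 h1q.le
    rw [mul_sub, mul_div_cancel₀ _ h1q.ne'] at this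
    linarith
  have k1 : (1 - ε) * ∫ t, crossEnt (pert μ₀ q ε x) t ∂μ₀ ≤ (1 - ε) * J :=
    mul_le_mul_of_nonneg_left hg (by linarith)
  have k2 : ε * q * crossEnt (pert μ₀ q ε x) 0 ≤ 0 :=
    mul_nonpos_of_nonneg_of_nonpos (by positivity) hn
  have k3 : ε * ((1 - q) * crossEnt (pert μ₀ q ε x) x) ≤ ε * (J - (1 - q)) :=
    mul_le_mul_of_nonneg_left hL3 he0.le
  have k4 : 0 < ε * (1 - q) := by positivity
  nlinarith

lemma outDen_map_neg (μ : Measure ℝ) (y : ℝ) :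
    outDen (Measure.map (fun x : ℝ => -x) μ) y = outDen μ (-y) := by
  unfold outDen
  rw [(MeasurableEquiv.neg ℝ).measurableEmbedding.integral_map
    (μ := μ) (g := fun x => gauss (y - x)) (f := (fun x : ℝ => -x))]
  refine integral_congr_ae (ae_of_all _ fun x => ?_)
  simp only
  rw [← gauss_neg]; congr 1; ring

lemma relEnt_map_neg (μ : Measure ℝ) (x : ℝ) :
    relEnt (-x) (Measure.map (fun x : ℝ => -x) μ) = relEnt x μ := by
  unfold relEnt
  rw [← integral_neg_eq_self]
  refine integral_congr_ae (ae_of_all _ fun y => ?_)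
  simp only [outDen_map_neg, neg_neg]
  rw [show -y - -x = -(y - x) by ring, gauss_neg]

lemma mutInfo_map_neg (μ : Measure ℝ) :
    mutInfo (Measure.map (fun x : ℝ => -x) μ) = mutInfo μ := by
  unfold mutInfo
  rw [(MeasurableEquiv.neg ℝ).measurableEmbedding.integral_map
    (μ := μ) (f := (fun x : ℝ => -x))]
  exact integral_congr_ae (ae_of_all _ fun x => relEnt_map_neg μ x)

lemma memLam_map_neg {γ q : ℝ} (μ : Measure ℝ) (h : memLam γ q μ) :
    memLam γ q (Measure.map (fun x : ℝ => -x) μ) := by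
  obtain ⟨hp, hz, hm⟩ := h
  refine ⟨Measure.isProbabilityMeasure_map measurable_neg.aemeasurable, ?_, ?_⟩
  · rw [Measure.map_apply measurable_neg (measurableSet_singleton 0)]
    simpa using hz
  · rw [lintegral_map (by fun_prop) measurable_neg]
    simpa using hm

/-- the unique maximizer `μ₀` of `I` over `Λ(γ,q)` is symmetric about `0`
(invariant under `x ↦ -x`) and its second moment equals `γ` exactly. -/
theorem maximizer_symmetric_and_full_power (q γ : ℝ) (hq0 : 0 < q) (hq1 : q < 1) (hγ : 0 < γ)
    (μ₀ : Measure ℝ) (h₀ : memLam γ q μ₀)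
    (hmax : ∀ μ : Measure ℝ, memLam γ q μ → mutInfo μ ≤ mutInfo μ₀)
    (huniq : ∀ μ : Measure ℝ, memLam γ q μ →
      (∀ μ' : Measure ℝ, memLam γ q μ' → mutInfo μ' ≤ mutInfo μ) → μ = μ₀) :
    Measure.map (fun x : ℝ => -x) μ₀ = μ₀ ∧
      ∫⁻ x, ENNReal.ofReal (x ^ 2) ∂μ₀ = ENNReal.ofReal γ := by
  refine ⟨huniq _ (memLam_map_neg μ₀ h₀) fun μ' h' => ?_, full_power hq0 hq1 μ₀ h₀ hmax⟩
  rw [mutInfo_map_neg]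
  exact hmax μ' h'
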